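/- arXiv:math/0406563 — 2 statements merged into one kernel-verified Lean document; each statement's English description precedes it below -/
import Mathlib

section
/- Let (H_t)_{t≥0} be a measurable real-valued stochastic process with E[|H_t|] < ∞ for all t, and for 0 ≤ s < u let H_{s,u} := σ(H_r : r ≤ s) ∨ σ(H_v : v ≥ u). Suppose that for every T > 0 there exists a process (M^{(T)}_t)_{0≤t<T} that is a martingale with respect to the filtration (H_{t,T})_{0≤t<T} and such that H_t = M^{(T)}_t + ∫_0^t (H_T − H_u)/(T − u) du almost surely for every 0 ≤ t < T. Then H is a harness: for all 0 ≤ s < t < u, E[H_t | H_{s,u}] = ((u−t) H_s + (t−s) H_u)/(u−s) almost surely. -/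
open MeasureTheory ProbabilityTheory Filter Set

/-- The past-future σ-field `σ(H_r : 0 ≤ r ≤ s) ⊔ σ(H_v : v ≥ u)` of a real-valued
process `H` indexed by nonnegative times. -/
def pastFuture {Ω : Type*} [MeasurableSpace Ω] (H : ℝ → Ω → ℝ) (s u : ℝ) :
    MeasurableSpace Ω :=
  (⨆ r ∈ Set.Icc (0 : ℝ) s, MeasurableSpace.comap (H r) inferInstance) ⊔
    (⨆ v ∈ Set.Ici u, MeasurableSpace.comap (H v) inferInstance)

/-- A measurable integrable process `H` is a harness if for all `0 ≤ s < t < u`,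
`E[H_t | H_{s,u}] = ((u−t) H_s + (t−s) H_u)/(u−s)` almost surely. -/
def IsHarness {Ω : Type*} [MeasurableSpace Ω] (μ : Measure Ω) (H : ℝ → Ω → ℝ) : Prop :=
  ∀ s t u : ℝ, 0 ≤ s → s < t → t < u →
    μ[H t | pastFuture H s u] =ᵐ[μ]
      fun ω => ((u - t) * H s ω + (t - s) * H u ω) / (u - s)

/-- Integration-by-parts formula when `h` is integrable. -/
lemma det_formula (h : ℝ → ℝ) (c T v : ℝ) (hv : 0 ≤ v) (hvT : v < T)
    (hh : IntervalIntegrable (fun r => (c - h r) / (T - r)) volume 0 v) :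
    (∫ r in (0:ℝ)..v, (c - h r) / (T - r)) =
      (T - v) * ∫ r in (0:ℝ)..v,
        (c - (h r - ∫ q in (0:ℝ)..r, (c - h q) / (T - q))) / (T - r) ^ 2 := by
  have hA := hh.absolutelyContinuousOnInterval_intervalIntegral (c := 0) (by simp)
  have hphi : AbsolutelyContinuousOnInterval (fun r : ℝ => (T - r)⁻¹) 0 v := by
    apply ContDiffOn.absolutelyContinuousOnInterval
    intro x hx
    rw [uIcc_of_le hv] at hx
    apply ContDiffAt.contDiffWithinAt
    apply ContDiffAt.inv
    · fun_prop
    · have := hx.2; linarith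
  have key := hA.integral_deriv_mul_eq_sub hphi
  have hcongr : (∫ x in (0:ℝ)..v, deriv (fun x => ∫ r in (0:ℝ)..x, (c - h r) / (T - r)) x * (T - x)⁻¹
      + (∫ r in (0:ℝ)..x, (c - h r) / (T - r)) * deriv (fun r : ℝ => (T - r)⁻¹) x) =
      ∫ r in (0:ℝ)..v,
        (c - (h r - ∫ q in (0:ℝ)..r, (c - h q) / (T - q))) / (T - r) ^ 2 := by
    apply intervalIntegral.integral_congr_ae
    filter_upwards [hh.ae_hasDerivAt_integral] with x hx hxm
    have hx1 := hx (uIoc_subset_uIcc hxm) 0 (by simp)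
    rw [uIoc_of_le hv] at hxm
    have hne : T - x ≠ 0 := by have := hxm.2; linarith
    have h2 : HasDerivAt (fun r : ℝ => (T - r)⁻¹) (1 / (T - x)^2) x := by
      have := ((hasDerivAt_id x).const_sub T).fun_inv hne
      simpa using this
    rw [hx1.deriv, h2.deriv]
    field_simp
    ring
  rw [← hcongr, key]
  have hne : T - v ≠ 0 := by linarith
  simp
  field_simp

lemma det_main (h : ℝ → ℝ) (hmeas : Measurable h) (c T t : ℝ) (ht : 0 ≤ t) (htT : t < T)
    (hm : IntegrableOn (fun u => h u - ∫ q in (0:ℝ)..u, (c - h q) / (T - q)) (Icc 0 t) volume) :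
    ∀ v ∈ Icc (0:ℝ) t, (∫ r in (0:ℝ)..v, (c - h r) / (T - r)) =
      (T - v) * ∫ r in (0:ℝ)..v,
        (c - (h r - ∫ q in (0:ℝ)..r, (c - h q) / (T - q))) / (T - r) ^ 2 := by
  set A : ℝ → ℝ := fun u => ∫ q in (0:ℝ)..u, (c - h q) / (T - q) with hAdef
  have hcont : ∀ n : ℕ, ContinuousOn (fun r : ℝ => ((T - r) ^ n)⁻¹) (Icc 0 t) := by
    intro n
    apply ContinuousOn.inv₀ (by fun_prop)
    intro x hx
    have := hx.2
    exact pow_ne_zero _ (by linarith)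
  have hF : IntegrableOn (fun r => (c - (h r - A r)) / (T - r) ^ 2) (Icc 0 t) volume := by
    have h1 : IntegrableOn (fun r => c - (h r - A r)) (Icc 0 t) volume :=
      (integrableOn_const (by simp)).sub hm
    simpa [div_eq_mul_inv] using h1.mul_continuousOn (hcont 2) isCompact_Icc
  have hbound : ∀ v ∈ Icc (0:ℝ) t, ‖A v‖ ≤
      T * ∫ r in Icc (0:ℝ) t, ‖(c - (h r - A r)) / (T - r) ^ 2‖ := by
    intro v hv
    have hnn : 0 ≤ ∫ r in Icc (0:ℝ) t, ‖(c - (h r - A r)) / (T - r) ^ 2‖ :=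
      integral_nonneg (fun _ => norm_nonneg _)
    by_cases hI : IntervalIntegrable (fun r => (c - h r) / (T - r)) volume 0 v
    · have e := det_formula h c T v hv.1 (by linarith [hv.2]) hI
      change A v = (T - v) * ∫ r in (0:ℝ)..v, (c - (h r - A r)) / (T - r) ^ 2 at e
      rw [e, norm_mul]
      have h1 : ‖T - v‖ ≤ T := by
        rw [Real.norm_eq_abs, abs_of_nonneg (by linarith [hv.2])]; linarith [hv.1]
      refine mul_le_mul h1 ?_ (norm_nonneg _) (by linarith)
      refine (intervalIntegral.norm_integral_le_integral_norm hv.1).trans ?_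
      rw [intervalIntegral.integral_of_le hv.1]
      exact setIntegral_mono_set hF.norm (ae_of_all _ fun _ => norm_nonneg _)
        (Eventually.of_forall fun x hx => ⟨hx.1.le, hx.2.trans hv.2⟩)
    · have : A v = 0 := intervalIntegral.integral_undef hI
      rw [this, norm_zero]
      exact mul_nonneg (by linarith) hnn
  have hAint : IntegrableOn A (Icc 0 t) volume := by
    have hAm : AEStronglyMeasurable A (volume.restrict (Icc 0 t)) := by
      have := hmeas.aestronglyMeasurable.sub hm.aestronglyMeasurable
      refine this.congr (ae_of_all _ fun x => ?_)
      simp [hAdef]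
    exact Integrable.of_bound hAm _
      ((ae_restrict_mem measurableSet_Icc).mono hbound)
  have hhint : IntegrableOn h (Icc 0 t) volume := by
    refine (hm.add hAint).congr (ae_of_all _ fun x => ?_)
    simp [hAdef]
  have hg : IntegrableOn (fun r => (c - h r) / (T - r)) (Icc 0 t) volume := by
    have h1 : IntegrableOn (fun r => c - h r) (Icc 0 t) volume :=
      (integrableOn_const (by simp)).sub hhint
    simpa [div_eq_mul_inv] using h1.mul_continuousOn (hcont 1) isCompact_Icc
  intro v hv
  apply det_formula h c T v hv.1 (by linarith [hv.2])
  rw [intervalIntegrable_iff_integrableOn_Icc_of_le hv.1]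
  exact hg.mono_set (Icc_subset_Icc_right hv.2)

lemma joint_meas {Ω : Type*} [MeasurableSpace Ω] (f : Ω → ℝ → ℝ)
    (hf : Measurable fun z : Ω × ℝ => f z.1 z.2) :
    Measurable fun p : ℝ × Ω => ∫ q in (0:ℝ)..p.1, f p.2 q := by
  have hF : Measurable fun z : (ℝ × Ω) × ℝ => f z.1.2 z.2 :=
    hf.comp ((measurable_snd.comp measurable_fst).prodMk measurable_snd)
  have h1 : Measurable fun p : ℝ × Ω => ∫ q, (Ioc (0:ℝ) p.1).indicator (f p.2) q := by
    have hs : MeasurableSet {z : (ℝ × Ω) × ℝ | 0 < z.2 ∧ z.2 ≤ z.1.1} :=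
      (measurableSet_lt measurable_const measurable_snd).inter
        (measurableSet_le measurable_snd (measurable_fst.comp measurable_fst))
    exact ((hF.indicator hs).stronglyMeasurable.integral_prod_right' (ν := volume)).measurable
  have h2 : Measurable fun p : ℝ × Ω => ∫ q, (Ioc p.1 (0:ℝ)).indicator (f p.2) q := by
    have hs : MeasurableSet {z : (ℝ × Ω) × ℝ | z.1.1 < z.2 ∧ z.2 ≤ 0} :=
      (measurableSet_lt (measurable_fst.comp measurable_fst) measurable_snd).inter
        (measurableSet_le measurable_snd measurable_const)
    exact ((hF.indicator hs).stronglyMeasurable.integral_prod_right' (ν := volume)).measurable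
  have := h1.sub h2
  simp only [integral_indicator measurableSet_Ioc] at this
  exact this

lemma pastFuture_le {Ω : Type*} [m0 : MeasurableSpace Ω] (H : ℝ → Ω → ℝ)
    (hmeas : Measurable fun p : ℝ × Ω => H p.1 p.2) (s u : ℝ) : pastFuture H s u ≤ m0 := by
  have h : ∀ r, Measurable (H r) := fun r => hmeas.comp measurable_prodMk_left
  unfold pastFuture
  exact sup_le (iSup₂_le fun r _ => (h r).comap_le) (iSup₂_le fun r _ => (h r).comap_le)

/-- Suppose that for every `T > 0` there is a process `(M^{(T)}_t)_{0 ≤ t < T}` which is a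
martingale with respect to the filtration `(H_{t,T})_{0 ≤ t < T}` (adapted, integrable,
with the conditional-expectation property) such that
`H_t = M^{(T)}_t + ∫_0^t (H_T − H_u)/(T − u) du` a.s. for all `0 ≤ t < T`.
Then `H` is a harness. -/
theorem harness_of_decomposition
    {Ω : Type*} [MeasurableSpace Ω] (μ : Measure Ω) [IsProbabilityMeasure μ]
    (H : ℝ → Ω → ℝ)
    (hmeas : Measurable fun p : ℝ × Ω => H p.1 p.2)
    (hint : ∀ t : ℝ, 0 ≤ t → Integrable (H t) μ)
    (hintI : ∀ T t : ℝ, 0 ≤ t → t < T →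
      Integrable (fun ω => ∫ u in (0 : ℝ)..t, (H T ω - H u ω) / (T - u)) μ)
    (hdec : ∀ T : ℝ, 0 < T → ∃ M : ℝ → Ω → ℝ,
      (∀ t : ℝ, 0 ≤ t → t < T → Measurable[pastFuture H t T] (M t)) ∧
      (∀ t : ℝ, 0 ≤ t → t < T → Integrable (M t) μ) ∧
      (∀ s t : ℝ, 0 ≤ s → s < t → t < T →
        μ[M t | pastFuture H s T] =ᵐ[μ] M s) ∧
      (∀ t : ℝ, 0 ≤ t → t < T →
        H t =ᵐ[μ] fun ω => M t ω + ∫ u in (0 : ℝ)..t, (H T ω - H u ω) / (T - u))) :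
    IsHarness μ H := by
  intro s t T hs hst htT
  have hT : 0 < T := by linarith
  have ht : 0 ≤ t := by linarith
  obtain ⟨M, -, hMint, hMmart, hMdec⟩ := hdec T hT
  have hle := pastFuture_le H hmeas s T
  have hHm : ∀ r, Measurable (H r) := fun r => hmeas.comp measurable_prodMk_left
  set A : ℝ → Ω → ℝ := fun v ω => ∫ q in (0:ℝ)..v, (H T ω - H q ω) / (T - q) with hA
  set N : ℝ → Ω → ℝ := fun v ω => H v ω - A v ω with hN
  have hAjm : Measurable fun p : ℝ × Ω => A p.1 p.2 := by
    apply joint_meas (fun ω q => (H T ω - H q ω) / (T - q))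
    exact (((hHm T).comp measurable_fst).sub (hmeas.comp measurable_swap)).div (by fun_prop)
  have hNjm : Measurable fun p : ℝ × Ω => N p.1 p.2 := hmeas.sub hAjm
  have hNM : ∀ v, 0 ≤ v → v < T → N v =ᵐ[μ] M v := by
    intro v h0 h1
    filter_upwards [hMdec v h0 h1] with ω hω
    simp only [hN]
    rw [hω]
    simp [hA]
  have hAint : ∀ v, 0 ≤ v → v < T → Integrable (A v) μ := fun v h0 h1 => hintI T v h0 h1
  have hNint : ∀ v, 0 ≤ v → v < T → Integrable (N v) μ := fun v h0 h1 =>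
    (hint v h0).sub (hAint v h0 h1)
  -- the L1 bound
  have hNbd : ∀ v ∈ Icc (0:ℝ) t, ∫ ω, ‖N v ω‖ ∂μ ≤ ∫ ω, ‖M t ω‖ ∂μ := by
    intro v hv
    have hvT : v < T := by linarith [hv.2]
    have e1 : ∫ ω, ‖N v ω‖ ∂μ = ∫ ω, ‖M v ω‖ ∂μ :=
      integral_congr_ae ((hNM v hv.1 hvT).fun_comp norm)
    rw [e1]
    rcases hv.2.eq_or_lt with rfl | hlt
    · exact le_rfl
    · have e2 : ∫ ω, ‖M v ω‖ ∂μ = ∫ ω, ‖(μ[M t | pastFuture H v T]) ω‖ ∂μ :=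
        integral_congr_ae ((hMmart v t hv.1 hlt htT).symm.fun_comp norm)
      rw [e2]
      exact integral_abs_condExp_le (M t)
  have hNprod : Integrable (fun p : ℝ × Ω => N p.1 p.2) ((volume.restrict (Icc 0 t)).prod μ) := by
    rw [integrable_prod_iff hNjm.aestronglyMeasurable]
    constructor
    · filter_upwards [ae_restrict_mem measurableSet_Icc] with v hv
      exact hNint v hv.1 (by linarith [hv.2])
    · refine Measure.integrableOn_of_bounded (M := ∫ ω, ‖M t ω‖ ∂μ) (by simp) ?_ ?_
      · exact (hNjm.norm.stronglyMeasurable.integral_prod_right (ν := μ)).aestronglyMeasurable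
      · filter_upwards [ae_restrict_mem measurableSet_Icc] with v hv
        rw [Real.norm_of_nonneg (integral_nonneg fun _ => norm_nonneg _)]
        exact hNbd v hv
  have hGprod : Integrable (fun p : ℝ × Ω => (H T p.2 - N p.1 p.2) / (T - p.1) ^ 2)
      ((volume.restrict (Icc 0 t)).prod μ) := by
    have h1 : Integrable (fun p : ℝ × Ω => H T p.2 - N p.1 p.2)
        ((volume.restrict (Icc 0 t)).prod μ) := ((hint T hT.le).comp_snd _).sub hNprod
    have h2 : Measurable fun p : ℝ × Ω => ((T - p.1) ^ 2)⁻¹ := by fun_prop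
    have h3 : ∀ᵐ p ∂((volume.restrict (Icc (0:ℝ) t)).prod μ), p.1 ∈ Icc (0:ℝ) t :=
      Measure.quasiMeasurePreserving_fst.ae (ae_restrict_mem measurableSet_Icc)
    simp_rw [div_eq_mul_inv]
    refine h1.mul_bdd (c := ((T - t) ^ 2)⁻¹) h2.aestronglyMeasurable ?_
    filter_upwards [h3] with p hp
    have hp2 := hp.2
    rw [Real.norm_of_nonneg (by positivity)]
    have : 0 < T - t := by linarith
    gcongr
  -- pathwise formula
  have hpath : ∀ᵐ ω ∂μ, A t ω / (T - t) - A s ω / (T - s) =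
      ∫ r in s..t, (H T ω - N r ω) / (T - r) ^ 2 := by
    filter_upwards [hNprod.prod_left_ae, hGprod.prod_left_ae] with ω h1 h2
    have hd := det_main (fun r => H r ω) (hmeas.comp measurable_prodMk_right) (H T ω) T t ht htT h1
    have et : A t ω = (T - t) * ∫ r in (0:ℝ)..t, (H T ω - N r ω) / (T - r) ^ 2 :=
      hd t ⟨ht, le_rfl⟩
    have es : A s ω = (T - s) * ∫ r in (0:ℝ)..s, (H T ω - N r ω) / (T - r) ^ 2 :=
      hd s ⟨hs, hst.le⟩
    have i1 : IntervalIntegrable (fun r => (H T ω - N r ω) / (T - r) ^ 2) volume 0 t := by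
      rw [intervalIntegrable_iff_integrableOn_Icc_of_le ht]; exact h2
    have i2 : IntervalIntegrable (fun r => (H T ω - N r ω) / (T - r) ^ 2) volume 0 s := by
      rw [intervalIntegrable_iff_integrableOn_Icc_of_le hs]
      exact IntegrableOn.mono_set h2 (Icc_subset_Icc_right hst.le)
    rw [et, es, mul_div_cancel_left₀ _ (by linarith), mul_div_cancel_left₀ _ (by linarith)]
    exact intervalIntegral.integral_interval_sub_left i1 i2
  have hRint : Integrable (fun ω => ((T - t) * H s ω + (t - s) * H T ω) / (T - s)) μ :=
    (((hint s hs).const_mul _).add ((hint T hT.le).const_mul _)).div_const _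
  symm
  refine ae_eq_condExp_of_forall_setIntegral_eq hle (hint t ht) (fun _ _ _ => hRint.integrableOn)
    ?_ ?_
  · intro B hB _
    have hTs : T - s ≠ 0 := by linarith
    have hTt : T - t ≠ 0 := by linarith
    have hsT : s < T := by linarith
    -- the martingale part
    have hm : ∀ r ∈ Icc s t, ∫ ω in B, N r ω ∂μ = ∫ ω in B, N s ω ∂μ := by
      intro r hr
      have hrT : r < T := by linarith [hr.2]
      have hr0 : 0 ≤ r := hs.trans hr.1
      rcases hr.1.eq_or_lt with rfl | hlt
      · rfl
      · rw [integral_congr_ae (ae_restrict_of_ae (hNM r hr0 hrT)),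
          integral_congr_ae (ae_restrict_of_ae (hNM s hs hsT)),
          ← setIntegral_condExp hle (hMint r hr0 hrT) hB]
        exact integral_congr_ae (ae_restrict_of_ae (hMmart s r hs hlt hrT))
    have hHdec : ∀ v, 0 ≤ v → v < T → ∫ ω in B, H v ω ∂μ =
        ∫ ω in B, N v ω ∂μ + ∫ ω in B, A v ω ∂μ := by
      intro v h0 h1
      rw [← integral_add (hNint v h0 h1).integrableOn (hAint v h0 h1).integrableOn]
      simp [hN]
    have hAdiff : (∫ ω in B, A t ω ∂μ) / (T - t) - (∫ ω in B, A s ω ∂μ) / (T - s) =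
        ((∫ ω in B, H T ω ∂μ) - ∫ ω in B, N s ω ∂μ) * (1 / (T - t) - 1 / (T - s)) := by
      rw [← integral_div, ← integral_div,
        ← integral_sub ((hAint t ht htT).integrableOn.div_const _)
          ((hAint s hs hsT).integrableOn.div_const _),
        integral_congr_ae (ae_restrict_of_ae hpath), ← intervalIntegral_integral_swap]
      · have e : ∫ r in s..t, ∫ ω in B, (H T ω - N r ω) / (T - r) ^ 2 ∂μ =
            ∫ r in s..t, ((∫ ω in B, H T ω ∂μ) - ∫ ω in B, N s ω ∂μ) * (1 / (T - r) ^ 2) := by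
          apply intervalIntegral.integral_congr
          intro r hr
          rw [uIcc_of_le hst.le] at hr
          simp only
          rw [integral_div, integral_sub (hint T hT.le).integrableOn
            (hNint r (hs.trans hr.1) (by linarith [hr.2])).integrableOn, hm r hr]
          ring
        rw [e, intervalIntegral.integral_const_mul]
        congr 1
        have hder : ∀ r ∈ uIcc s t, HasDerivAt (fun r : ℝ => 1 / (T - r)) (1 / (T - r) ^ 2) r := by
          intro r hr
          rw [uIcc_of_le hst.le] at hr
          have hne : T - r ≠ 0 := by have := hr.2; linarith
          have := ((hasDerivAt_id r).const_sub T).fun_inv hne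
          simpa using this
        refine intervalIntegral.integral_eq_sub_of_hasDerivAt hder ?_
        apply ContinuousOn.intervalIntegrable
        apply ContinuousOn.div (by fun_prop) (by fun_prop)
        intro r hr
        rw [uIcc_of_le hst.le] at hr
        have := hr.2
        exact pow_ne_zero _ (by linarith)
      · refine hGprod.mono_measure ?_
        refine Measure.prod_mono (Measure.restrict_mono ?_ le_rfl) Measure.restrict_le_self
        rw [uIoc_of_le hst.le]
        exact fun x hx => ⟨hs.trans hx.1.le, hx.2⟩
    rw [integral_div, integral_add ((hint s hs).const_mul _).integrableOn
      ((hint T hT.le).const_mul _).integrableOn, integral_const_mul, integral_const_mul,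
      hHdec s hs hsT, hHdec t ht htT, hm t ⟨hst.le, le_rfl⟩]
    field_simp at hAdiff ⊢
    linarith
  · have hmem : ∀ r, (r ∈ Icc 0 s ∨ r ∈ Ici T) → Measurable[pastFuture H s T] (H r) := by
      intro r hr
      rw [measurable_iff_comap_le]
      unfold pastFuture
      rcases hr with hr | hr
      · exact le_sup_of_le_left (le_iSup₂_of_le r hr le_rfl)
      · exact le_sup_of_le_right (le_iSup₂_of_le r hr le_rfl)
    have m1 := hmem s (Or.inl ⟨hs, le_rfl⟩)
    have m2 := hmem T (Or.inr self_mem_Ici)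
    have : Measurable[pastFuture H s T]
        (fun ω => ((T - t) * H s ω + (t - s) * H T ω) / (T - s)) :=
      ((m1.const_mul _).add (m2.const_mul _)).div_const _
    exact this.stronglyMeasurable.aestronglyMeasurable
end

section
/- Let (B_t)_{t≥0} be a standard one-dimensional Brownian motion with B_0 = 0, and fix T > 0. Define γ^{(T)}_t := B_t − ∫_0^t (B_T − B_s)/(T − s) ds for 0 ≤ t ≤ T (the integral being a pathwise Lebesgue integral, which is a.s. absolutely convergent). Then (γ^{(T)}_t)_{0≤t≤T} is a standard Brownian motion on [0,T] with respect to the initially enlarged filtration B^{(T)}_t := σ(B_r : r ≤ t) ∨ σ(B_T); in particular (γ^{(T)}_t)_{0≤t≤T} is a martingale with respect to (B^{(T)}_t)_{0≤t≤T} and the process (γ^{(T)}_t)_{0≤t≤T} is independent of B_T. -/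
open MeasureTheory ProbabilityTheory Filter Set

/-- A standard one-dimensional Brownian motion on `[0,∞)`: a measurable real-valued
process with a.s. continuous paths, `B_0 = 0` a.s., whose increments `B_t − B_s`
(`0 ≤ s ≤ t`) are independent of `σ(B_r : r ≤ s)` and Gaussian with mean `0` and
variance `t − s`. -/
structure IsStandardBM {Ω : Type*} [MeasurableSpace Ω] (μ : Measure Ω)
    (B : ℝ → Ω → ℝ) : Prop where
  meas : ∀ t : ℝ, Measurable (B t)
  zero : ∀ᵐ ω ∂μ, B 0 ω = 0
  cont : ∀ᵐ ω ∂μ, ContinuousOn (fun t => B t ω) (Set.Ici 0)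
  indep : ∀ s t : ℝ, 0 ≤ s → s ≤ t →
    Indep (MeasurableSpace.comap (fun ω => B t ω - B s ω) inferInstance)
      (⨆ r ∈ Set.Icc (0 : ℝ) s, MeasurableSpace.comap (B r) inferInstance) μ
  gauss : ∀ s t : ℝ, 0 ≤ s → s ≤ t →
    μ.map (fun ω => B t ω - B s ω) = gaussianReal 0 (Real.toNNReal (t - s))

/-- The initially enlarged filtration `B^{(T)}_t = σ(B_r : r ≤ t) ∨ σ(B_T)`. -/
def enlarged {Ω : Type*} [MeasurableSpace Ω] (B : ℝ → Ω → ℝ) (T t : ℝ) :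
    MeasurableSpace Ω :=
  (⨆ r ∈ Set.Icc (0 : ℝ) t, MeasurableSpace.comap (B r) inferInstance) ⊔
    MeasurableSpace.comap (B T) inferInstance

open scoped Topology

/-- Conditionally on `m`, the variable `D` is centred Gaussian with variance `v`. -/
def CG {Ω : Type*} {m0 : MeasurableSpace Ω} (μ : Measure Ω) (D : Ω → ℝ) (v : ℝ)
    (m : MeasurableSpace Ω) : Prop :=
  ∀ θ : ℝ, ∀ A : Set Ω, MeasurableSet[m] A →
    ∫ ω in A, Complex.exp (θ * D ω * Complex.I) ∂μ
      = Complex.exp (-(v * θ ^ 2 / 2)) * (μ.real A : ℂ)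

section CGlemmas
variable {Ω : Type*} {m m' m1 m2 m3 : MeasurableSpace Ω} {m0 : MeasurableSpace Ω} {μ : Measure Ω}

lemma CG.congr {D D' : Ω → ℝ} {v : ℝ} (h : CG μ D v m)
    (hD : D =ᵐ[μ] D') : CG μ D' v m := by
  intro θ A hA
  rw [← h θ A hA]
  apply integral_congr_ae
  filter_upwards [ae_restrict_of_ae hD] with ω hω
  rw [hω]

lemma CG.mono {D : Ω → ℝ} {v : ℝ} (h : CG μ D v m)
    (hm : m' ≤ m) : CG μ D v m' := fun θ A hA => h θ A (hm A hA)

lemma CG.indep_map [IsProbabilityMeasure μ] {D : Ω → ℝ} {v : ℝ}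
    (h : CG μ D v m) (hv : 0 ≤ v) (hm : m ≤ m0) (hD : AEMeasurable D μ) :
    Indep (MeasurableSpace.comap D inferInstance) m μ ∧
      μ.map D = gaussianReal 0 v.toNNReal := by
  have key : ∀ A, MeasurableSet[m] A → (μ.restrict A).map D = (μ A) • gaussianReal 0 v.toNNReal := by
    intro A hA
    have : IsFiniteMeasure ((μ A) • gaussianReal 0 v.toNNReal) :=
      ⟨by simp⟩
    apply Measure.ext_of_charFun
    ext θ
    rw [charFun_apply_real, integral_map hD.restrict (by fun_prop), h θ A hA, charFun_apply_real,
      integral_smul_measure, ← charFun_apply_real, charFun_gaussianReal]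
    simp [Measure.real, hv, mul_comm]
  have huniv : μ.map D = gaussianReal 0 v.toNNReal := by
    have := key univ MeasurableSet.univ
    simpa using this
  refine ⟨?_, huniv⟩
  rw [Indep_iff]
  rintro _ A ⟨s, hs, rfl⟩ hA
  have h1 := congrArg (fun ν : Measure ℝ => ν s) (key A hA)
  rw [Measure.map_apply_of_aemeasurable hD.restrict hs, Measure.restrict_apply' (hm A hA),
    Measure.smul_apply, ← huniv, Measure.map_apply_of_aemeasurable hD hs] at h1
  rw [h1, smul_eq_mul, mul_comm]

lemma CG.of_indep [IsProbabilityMeasure μ] {D : Ω → ℝ} {v : ℝ}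
    (hv : 0 ≤ v) (hD : Measurable D)
    (hi : Indep (MeasurableSpace.comap D inferInstance) m μ)
    (hmap : μ.map D = gaussianReal 0 v.toNNReal) : CG μ D v m := by
  intro θ A hA
  have key : (μ.restrict A).map D = (μ A) • gaussianReal 0 v.toNNReal := by
    ext s hs
    rw [Measure.map_apply hD hs, Measure.restrict_apply (hD hs), Measure.smul_apply, ← hmap,
      Measure.map_apply hD hs, smul_eq_mul, mul_comm]
    exact (Indep_iff _ _ _).1 hi _ _ ⟨s, hs, rfl⟩ hA
  have h1 : ∫ ω in A, Complex.exp (θ * D ω * Complex.I) ∂μ = charFun ((μ.restrict A).map D) θ := by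
    rw [charFun_apply_real, integral_map hD.aemeasurable (by fun_prop)]
  rw [h1, key, charFun_apply_real, integral_smul_measure, ← charFun_apply_real,
    charFun_gaussianReal]
  simp [Measure.real, hv, mul_comm]

lemma CG.add [IsProbabilityMeasure μ] {X Y : Ω → ℝ} {v w : ℝ}
    (h12 : m1 ≤ m2) (hm : m2 ≤ m0) (hY : Measurable[m2] Y) (hX : Measurable X) (hw : 0 ≤ w)
    (hYv : CG μ Y v m1) (hXw : CG μ X w m2) : CG μ (fun ω => Y ω + X ω) (v + w) m1 := by
  intro θ A hA
  have hi := (hXw.indep_map hw hm hX.aemeasurable).1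
  have hA2 : MeasurableSet[m2] A := h12 A hA
  have hA0 : MeasurableSet A := hm A hA2
  let f : Ω → ℂ := fun ω => Complex.exp (θ * X ω * Complex.I)
  let g : Ω → ℂ := A.indicator (fun ω => Complex.exp (θ * Y ω * Complex.I))
  have hf : Measurable[MeasurableSpace.comap X inferInstance] f := by
    have : f = (fun x : ℝ => Complex.exp (θ * x * Complex.I)) ∘ X := rfl
    rw [this]
    exact Measurable.comp (by fun_prop) (comap_measurable X)
  have hg : Measurable[m2] g := by
    refine Measurable.indicator ?_ hA2
    exact Measurable.comp (g := fun x : ℝ => Complex.exp (θ * x * Complex.I)) (by fun_prop) hY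
  have hfg : IndepFun f g μ := by
    rw [IndepFun_iff_Indep]
    exact indep_of_indep_of_le_left (indep_of_indep_of_le_right hi hg.comap_le) hf.comap_le
  have e1 := hfg.integral_fun_mul_eq_mul_integral
    ((hf.mono hX.comap_le le_rfl).aestronglyMeasurable) ((hg.mono hm le_rfl).aestronglyMeasurable)
  have e2 : ∫ ω, f ω ∂μ = Complex.exp (-(w * θ ^ 2 / 2)) := by
    have := hXw θ univ MeasurableSet.univ
    simpa using this
  have e3 : ∫ ω, g ω ∂μ = Complex.exp (-(v * θ ^ 2 / 2)) * (μ.real A : ℂ) := by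
    rw [integral_indicator hA0]; exact hYv θ A hA
  have e4 : ∫ ω in A, Complex.exp (θ * (↑(Y ω + X ω)) * Complex.I) ∂μ = ∫ ω, f ω * g ω ∂μ := by
    rw [← integral_indicator hA0]
    congr 1; ext ω
    by_cases hω : ω ∈ A
    · simp only [g, f, hω, indicator_of_mem, ← Complex.exp_add]; congr 1; push_cast; ring
    · simp [g, hω]
  rw [e4, e1, e2, e3, ← mul_assoc, ← Complex.exp_add]
  congr 2; push_cast; ring

lemma CG.tendsto [IsProbabilityMeasure μ] {D : ℕ → Ω → ℝ} {D' : Ω → ℝ} {v : ℕ → ℝ} {v' : ℝ}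
 (hD : ∀ n, AEMeasurable (D n) μ) (h : ∀ n, CG μ (D n) (v n) m)
    (hv : Tendsto v atTop (𝓝 v')) (hlim : ∀ᵐ ω ∂μ, Tendsto (fun n => D n ω) atTop (𝓝 (D' ω))) :
    CG μ D' v' m := by
  intro θ A hA
  have l1 : Tendsto (fun n => ∫ ω in A, Complex.exp (θ * D n ω * Complex.I) ∂μ) atTop
      (𝓝 (∫ ω in A, Complex.exp (θ * D' ω * Complex.I) ∂μ)) := by
    apply tendsto_integral_of_dominated_convergence (fun _ => (1 : ℝ))
    · intro n
      have := (hD n).restrict (s := A)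
      exact (Measurable.comp_aemeasurable (g := fun x : ℝ => Complex.exp (θ * x * Complex.I))
        (by fun_prop) this).aestronglyMeasurable
    · exact integrable_const _
    · intro n
      filter_upwards with ω
      rw [← Complex.ofReal_mul, Complex.norm_exp_ofReal_mul_I]
    · filter_upwards [ae_restrict_of_ae hlim] with ω hω
      have hc : Continuous (fun x : ℝ => Complex.exp (θ * x * Complex.I)) := by fun_prop
      exact (hc.tendsto _).comp hω
  have l2 : Tendsto (fun n => Complex.exp (-(v n * θ ^ 2 / 2)) * (μ.real A : ℂ)) atTop
      (𝓝 (Complex.exp (-(v' * θ ^ 2 / 2)) * (μ.real A : ℂ))) := by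
    have hc : Continuous (fun x : ℝ => Complex.exp (-(x * θ ^ 2 / 2)) * (μ.real A : ℂ)) := by
      fun_prop
    exact (hc.tendsto _).comp hv
  refine tendsto_nhds_unique l1 (l2.congr fun n => ?_)
  exact (h n θ A hA).symm

lemma indep_aux [IsProbabilityMeasure μ] (h1 : m1 ≤ m0)
    (h2 : m2 ≤ m0) (h3 : m3 ≤ m0) (h12 : Indep m1 m2 μ) (h123 : Indep (m1 ⊔ m2) m3 μ) :
    Indep m1 (m2 ⊔ m3) μ := by
  let p : Set (Set Ω) := {s | ∃ a b, MeasurableSet[m2] a ∧ MeasurableSet[m3] b ∧ s = a ∩ b}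
  have hp : IsPiSystem p := by
    rintro _ ⟨a, b, ha, hb, rfl⟩ _ ⟨c, d, hc, hd, rfl⟩ _
    exact ⟨a ∩ c, b ∩ d, ha.inter hc, hb.inter hd, Set.inter_inter_inter_comm a b c d⟩
  have hgen : m2 ⊔ m3 = MeasurableSpace.generateFrom p := by
    apply le_antisymm
    · apply sup_le
      · intro a ha
        exact MeasurableSpace.measurableSet_generateFrom ⟨a, univ, ha, MeasurableSet.univ, by simp⟩
      · intro a ha
        exact MeasurableSpace.measurableSet_generateFrom ⟨univ, a, MeasurableSet.univ, ha, by simp⟩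
    · apply MeasurableSpace.generateFrom_le
      rintro _ ⟨a, b, ha, hb, rfl⟩
      have ha' : MeasurableSet[m2 ⊔ m3] a := (le_sup_left : m2 ≤ m2 ⊔ m3) a ha
      have hb' : MeasurableSet[m2 ⊔ m3] b := (le_sup_right : m3 ≤ m2 ⊔ m3) b hb
      exact ha'.inter hb'
  refine IndepSets.indep h1 (sup_le h2 h3) (@MeasurableSpace.isPiSystem_measurableSet Ω m1) hp
    (@MeasurableSpace.generateFrom_measurableSet Ω m1).symm hgen ?_
  rw [IndepSets_iff]
  rintro s _ hs ⟨a, b, ha, hb, rfl⟩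
  rw [Indep_iff] at h12 h123
  have hs' : MeasurableSet[m1 ⊔ m2] s := (le_sup_left : m1 ≤ m1 ⊔ m2) s hs
  have ha' : MeasurableSet[m1 ⊔ m2] a := (le_sup_right : m2 ≤ m1 ⊔ m2) a ha
  rw [← Set.inter_assoc, h123 _ _ (hs'.inter ha') hb, h12 _ _ hs ha, h123 _ _ ha' hb, mul_assoc]

lemma ae_limit_measurable {f : ℕ → Ω → ℝ} {g : Ω → ℝ}
    (hf : ∀ n, ∃ f' : Ω → ℝ, Measurable[m] f' ∧ f n =ᵐ[μ] f')
    (hlim : ∀ᵐ ω ∂μ, Tendsto (fun n => f n ω) atTop (𝓝 (g ω))) :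
    ∃ g' : Ω → ℝ, Measurable[m] g' ∧ g =ᵐ[μ] g' := by
  choose f' hf' he using hf
  refine ⟨fun ω => limsup (fun n => f' n ω) atTop, Measurable.limsup hf', ?_⟩
  filter_upwards [hlim, ae_all_iff.2 he] with ω h1 h2
  simp only [h2] at h1
  exact h1.limsup_eq.symm
end CGlemmas

/-- The natural past. -/
abbrev past {Ω : Type*} (B : ℝ → Ω → ℝ) (u : ℝ) : MeasurableSpace Ω :=
  ⨆ r ∈ Set.Icc (0 : ℝ) u, MeasurableSpace.comap (B r) inferInstance

set_option linter.unusedSectionVars false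

section BMlemmas
variable {Ω : Type*} [MeasurableSpace Ω] {μ : Measure Ω} [IsProbabilityMeasure μ]
  {B : ℝ → Ω → ℝ}

lemma two_gauss {P Q : Ω → ℝ} {h k a b : ℝ} (hh : 0 ≤ h) (hk : 0 ≤ k)
    (hP : μ.map P = gaussianReal 0 h.toNNReal) (hQ : μ.map Q = gaussianReal 0 k.toNNReal)
    (hPQ : IndepFun P Q μ) (hab : a * h = b * k) :
    IndepFun (fun ω => a * P ω - b * Q ω) (fun ω => P ω + Q ω) μ ∧
    μ.map (fun ω => a * P ω - b * Q ω) = gaussianReal 0 (a ^ 2 * h + b ^ 2 * k).toNNReal := by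
  have gP : HasGaussianLaw P μ := ⟨by rw [hP]; infer_instance⟩
  have gQ : HasGaussianLaw Q μ := ⟨by rw [hQ]; infer_instance⟩
  have gPQ := hPQ.hasGaussianLaw gP gQ
  have vP : cov[P, P; μ] = h := by
    rw [covariance_self gP.aemeasurable, ← variance_id_map gP.aemeasurable, hP,
      variance_id_gaussianReal]
    simp [hh]
  have vQ : cov[Q, Q; μ] = k := by
    rw [covariance_self gQ.aemeasurable, ← variance_id_map gQ.aemeasurable, hQ,
      variance_id_gaussianReal]
    simp [hk]
  have cPQ : cov[P, Q; μ] = 0 := hPQ.covariance_eq_zero gP.memLp_two gQ.memLp_two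
  have cQP : cov[Q, P; μ] = 0 := by rw [covariance_comm]; exact cPQ
  have eP : ∫ ω, P ω ∂μ = 0 := by
    have := integral_map gP.aemeasurable (f := fun x : ℝ => x) (by fun_prop)
    rw [← this, hP, integral_id_gaussianReal]
  have eQ : ∫ ω, Q ω ∂μ = 0 := by
    have := integral_map gQ.aemeasurable (f := fun x : ℝ => x) (by fun_prop)
    rw [← this, hQ, integral_id_gaussianReal]
  let L1 : ℝ × ℝ →L[ℝ] ℝ :=
    a • ContinuousLinearMap.fst ℝ ℝ ℝ - b • ContinuousLinearMap.snd ℝ ℝ ℝ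
  let L2 : ℝ × ℝ →L[ℝ] ℝ := ContinuousLinearMap.fst ℝ ℝ ℝ + ContinuousLinearMap.snd ℝ ℝ ℝ
  have gX : HasGaussianLaw (fun ω => (a * P ω - b * Q ω, P ω + Q ω)) μ :=
    gPQ.map_fun (L1.prod L2)
  have maP : MemLp (fun ω => a * P ω) 2 μ := gP.memLp_two.const_mul a
  have mbQ : MemLp (fun ω => b * Q ω) 2 μ := gQ.memLp_two.const_mul b
  have c1 : ∀ Z, MemLp Z 2 μ → cov[fun ω => a * P ω - b * Q ω, Z; μ] =
      a * cov[P, Z; μ] - b * cov[Q, Z; μ] := by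
    intro Z hZ
    rw [covariance_fun_sub_left maP mbQ hZ, covariance_const_mul_left, covariance_const_mul_left]
  refine ⟨?_, ?_⟩
  · apply gX.indepFun_of_covariance_eq_zero
    rw [c1 _ (gX.snd.memLp_two)]
    change a * cov[P, P + Q; μ] - b * cov[Q, P + Q; μ] = 0
    rw [covariance_add_right gP.memLp_two gP.memLp_two gQ.memLp_two,
      covariance_add_right gQ.memLp_two gP.memLp_two gQ.memLp_two, vP, vQ, cPQ, cQP]
    linarith
  · rw [gX.fst.map_eq_gaussianReal]
    congr 1
    · rw [integral_sub (gP.integrable.const_mul a) (gQ.integrable.const_mul b),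
        integral_const_mul, integral_const_mul, eP, eQ]; simp
    · congr 1
      rw [← covariance_self gX.fst.aemeasurable, c1 _ gX.fst.memLp_two, covariance_comm P,
        c1 _ gP.memLp_two, covariance_comm Q (fun ω => a * P ω - b * Q ω), c1 _ gQ.memLp_two, vP, vQ, cPQ, cQP]
      ring

lemma past_le (hB : IsStandardBM μ B) (u : ℝ) :
    (⨆ r ∈ Set.Icc (0 : ℝ) u, MeasurableSpace.comap (B r) inferInstance) ≤ ‹MeasurableSpace Ω› :=
  iSup₂_le fun r _ => (hB.meas r).comap_le

lemma past_mono {u v : ℝ} (huv : u ≤ v) :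
    (⨆ r ∈ Set.Icc (0 : ℝ) u, MeasurableSpace.comap (B r) inferInstance) ≤
    (⨆ r ∈ Set.Icc (0 : ℝ) v, MeasurableSpace.comap (B r) inferInstance) :=
  biSup_mono fun _ hr => ⟨hr.1, hr.2.trans huv⟩

lemma past_meas {r u : ℝ} (h0 : 0 ≤ r) (hr : r ≤ u) :
    Measurable[⨆ r ∈ Set.Icc (0 : ℝ) u, MeasurableSpace.comap (B r) inferInstance] (B r) :=
  Measurable.mono (comap_measurable (B r))
    (le_iSup₂_of_le (f := fun r (_ : r ∈ Set.Icc (0 : ℝ) u) =>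
      MeasurableSpace.comap (B r) inferInstance) r ⟨h0, hr⟩ le_rfl) le_rfl

lemma enlarged_le (hB : IsStandardBM μ B) (T u : ℝ) : enlarged B T u ≤ ‹MeasurableSpace Ω› :=
  sup_le (past_le hB u) (hB.meas T).comap_le

lemma enlarged_mono (T : ℝ) {u v : ℝ} (huv : u ≤ v) : enlarged B T u ≤ enlarged B T v :=
  sup_le_sup_right (past_mono huv) _

lemma enlarged_meas (T : ℝ) {r u : ℝ} (h0 : 0 ≤ r) (hr : r ≤ u) :
    Measurable[enlarged B T u] (B r) :=
  (past_meas h0 hr).mono le_sup_left le_rfl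

lemma enlarged_meas_T (T : ℝ) {u : ℝ} : Measurable[enlarged B T u] (B T) :=
  (comap_measurable (B T)).mono le_sup_right le_rfl

lemma step_CG (hB : IsStandardBM μ B) {T u v : ℝ} (hu : 0 ≤ u) (huv : u ≤ v) (hvT : v ≤ T)
    (huT : u < T) :
    CG μ (fun ω => (B v ω - B u ω) - (v - u) * ((B T ω - B u ω) / (T - u)))
      ((v - u) - (v - u) ^ 2 / (T - u)) (enlarged B T u) := by
  have hL : 0 < T - u := by linarith
  let P : Ω → ℝ := fun ω => B v ω - B u ω
  let Q : Ω → ℝ := fun ω => B T ω - B v ω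
  have hmP : Measurable P := (hB.meas v).sub (hB.meas u)
  have hmQ : Measurable Q := (hB.meas T).sub (hB.meas v)
  have hF : past B u ≤ ‹MeasurableSpace Ω› := past_le hB u
  have hPF : Indep (MeasurableSpace.comap P inferInstance) (past B u) μ := hB.indep u v hu huv
  have hQF : Indep (MeasurableSpace.comap Q inferInstance) _ μ :=
    hB.indep v T (hu.trans huv) hvT
  have hPv : MeasurableSpace.comap P inferInstance ≤
      ⨆ r ∈ Set.Icc (0 : ℝ) v, MeasurableSpace.comap (B r) inferInstance := by
    apply Measurable.comap_le
    exact Measurable.sub (past_meas (hu.trans huv) le_rfl) (past_meas hu huv)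
  have hPQ : IndepFun P Q μ := by
    rw [IndepFun_iff_Indep]
    exact (indep_of_indep_of_le_right hQF hPv).symm
  have hQFP : Indep (past B u ⊔ MeasurableSpace.comap P inferInstance)
      (MeasurableSpace.comap Q inferInstance) μ :=
    (indep_of_indep_of_le_right hQF (sup_le (past_mono huv) hPv)).symm
  have hFPQ := indep_aux hF hmP.comap_le hmQ.comap_le hPF.symm hQFP
  have hPm : Measurable[MeasurableSpace.comap P inferInstance ⊔
      MeasurableSpace.comap Q inferInstance] P := (comap_measurable P).mono le_sup_left le_rfl
  have hQm : Measurable[MeasurableSpace.comap P inferInstance ⊔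
      MeasurableSpace.comap Q inferInstance] Q := (comap_measurable Q).mono le_sup_right le_rfl
  have htg := two_gauss (a := (T - v) / (T - u)) (b := (v - u) / (T - u)) (sub_nonneg.2 huv)
    (sub_nonneg.2 hvT) (hB.gauss u v hu huv) (hB.gauss v T (hu.trans huv) hvT) hPQ (by ring)
  let X : Ω → ℝ := fun ω => (T - v) / (T - u) * P ω - (v - u) / (T - u) * Q ω
  let R : Ω → ℝ := fun ω => P ω + Q ω
  have hX : (fun ω => (B v ω - B u ω) - (v - u) * ((B T ω - B u ω) / (T - u))) = X := by
    ext ω; simp only [X, P, Q]; field_simp; ring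
  have hvar : ((v - u) - (v - u) ^ 2 / (T - u)) =
      ((T - v) / (T - u)) ^ 2 * (v - u) + ((v - u) / (T - u)) ^ 2 * (T - v) := by
    field_simp; ring
  have hmX : Measurable X := (hmP.const_mul _).sub (hmQ.const_mul _)
  have hmR : Measurable R := hmP.add hmQ
  have hXm : Measurable[MeasurableSpace.comap P inferInstance ⊔
      MeasurableSpace.comap Q inferInstance] X :=
    Measurable.sub (Measurable.const_mul hPm _) (Measurable.const_mul hQm _)
  have hRm : Measurable[MeasurableSpace.comap P inferInstance ⊔
      MeasurableSpace.comap Q inferInstance] R := Measurable.add hPm hQm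
  have hXR : Indep (MeasurableSpace.comap X inferInstance)
      (MeasurableSpace.comap R inferInstance) μ := (IndepFun_iff_Indep _ _ _).1 htg.1
  have hXRF := indep_aux hmX.comap_le hmR.comap_le hF hXR
    (indep_of_indep_of_le_right hFPQ (sup_le hXm.comap_le hRm.comap_le)).symm
  have hen : enlarged B T u ≤ MeasurableSpace.comap R inferInstance ⊔ past B u := by
    refine sup_le le_sup_right ?_
    apply Measurable.comap_le
    have : B T = fun ω => R ω + B u ω := by ext ω; simp only [R, P, Q]; ring
    rw [this]
    exact Measurable.add ((comap_measurable R).mono le_sup_left le_rfl)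
      ((past_meas hu le_rfl).mono le_sup_right le_rfl)
  rw [hX, hvar]
  refine CG.of_indep ?_ hmX (indep_of_indep_of_le_right hXRF hen) htg.2
  have := sub_nonneg.2 huv
  have := sub_nonneg.2 hvT
  positivity

lemma riemann_tendsto {f : ℝ → ℝ} {s t : ℝ} (hst : s ≤ t) (hf : ContinuousOn f (Icc s t)) :
    Tendsto (fun n : ℕ => ∑ k ∈ Finset.range (n + 1),
      ((s + (k + 1 : ℕ) * ((t - s) / (n + 1))) - (s + k * ((t - s) / (n + 1)))) *
        f (s + k * ((t - s) / (n + 1)))) atTop (𝓝 (∫ x in s..t, f x)) := by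
  have huc := isCompact_Icc.uniformContinuousOn_of_continuous hf
  rw [Metric.tendsto_atTop]
  intro ε hε
  rw [Metric.uniformContinuousOn_iff] at huc
  obtain ⟨δ, hδ, huc⟩ := huc (ε / (t - s + 1)) (by apply div_pos hε; linarith)
  obtain ⟨N, hN⟩ := exists_nat_gt ((t - s) / δ)
  refine ⟨N, fun n hn => ?_⟩
  have hn1 : (0 : ℝ) < (n : ℝ) + 1 := by positivity
  set Δ := (t - s) / ((n : ℝ) + 1) with hΔ
  have hΔ0 : 0 ≤ Δ := div_nonneg (by linarith) hn1.le
  have hΔδ : Δ < δ := by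
    rw [hΔ, div_lt_iff₀ hn1]
    rw [div_lt_iff₀ hδ] at hN
    have : (N : ℝ) ≤ n := by exact_mod_cast hn
    nlinarith
  have hend : s + ((n + 1 : ℕ) : ℝ) * Δ = t := by
    rw [hΔ]; push_cast; field_simp; ring
  have hpt : ∀ k ≤ n + 1, s + (k : ℝ) * Δ ∈ Icc s t := by
    intro k hk
    refine ⟨by have : 0 ≤ (k : ℝ) * Δ := by positivity
               linarith, ?_⟩
    rw [← hend]
    have : (k : ℝ) ≤ ((n + 1 : ℕ) : ℝ) := by exact_mod_cast hk
    nlinarith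
  have hIntg : ∀ k < n + 1, IntervalIntegrable f volume (s + (k : ℝ) * Δ)
      (s + ((k + 1 : ℕ) : ℝ) * Δ) := by
    intro k hk
    apply ContinuousOn.intervalIntegrable
    apply hf.mono
    rw [uIcc_of_le (by push_cast; nlinarith)]
    exact Icc_subset_Icc (hpt k hk.le).1 (hpt (k + 1) hk).2
  have hsum := intervalIntegral.sum_integral_adjacent_intervals
    (a := fun k : ℕ => s + (k : ℝ) * Δ) hIntg
  rw [hend] at hsum
  simp only [Nat.cast_zero, zero_mul, add_zero] at hsum
  rw [dist_eq_norm, ← hsum, ← Finset.sum_sub_distrib]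
  have hterm : ∀ k ∈ Finset.range (n + 1),
      ‖((s + (k + 1 : ℕ) * Δ) - (s + k * Δ)) * f (s + k * Δ)
        - ∫ x in (s + (k : ℝ) * Δ)..(s + ((k + 1 : ℕ) : ℝ) * Δ), f x‖
        ≤ (ε / (t - s + 1)) * Δ := by
    intro k hk
    rw [Finset.mem_range] at hk
    have hle : s + (k : ℝ) * Δ ≤ s + ((k + 1 : ℕ) : ℝ) * Δ := by push_cast; nlinarith
    have e1 : ((s + (k + 1 : ℕ) * Δ) - (s + k * Δ)) * f (s + k * Δ)
        = ∫ x in (s + (k : ℝ) * Δ)..(s + ((k + 1 : ℕ) : ℝ) * Δ), f (s + k * Δ) := by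
      rw [intervalIntegral.integral_const, smul_eq_mul]
    rw [e1, ← intervalIntegral.integral_sub (by simp) (hIntg k hk)]
    have := intervalIntegral.norm_integral_le_of_norm_le_const (C := ε / (t - s + 1))
      (f := fun x => f (s + k * Δ) - f x) (a := s + (k : ℝ) * Δ) (b := s + ((k + 1 : ℕ) : ℝ) * Δ) ?_
    · refine this.trans (le_of_eq ?_)
      congr 1
      push_cast
      rw [show s + ((k : ℝ) + 1) * Δ - (s + k * Δ) = Δ by ring, abs_of_nonneg hΔ0]
    · intro x hx
      rw [uIoc_of_le hle] at hx
      rw [← dist_eq_norm]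
      refine (huc _ (hpt k hk.le) x ⟨(hpt k hk.le).1.trans hx.1.le, hx.2.trans (hpt (k+1) hk).2⟩ ?_).le
      rw [dist_comm, Real.dist_eq, abs_of_pos (by linarith [hx.1])]
      have := hx.2
      push_cast at this
      linarith
  refine (norm_sum_le_of_le _ hterm).trans_lt ?_
  rw [Finset.sum_const, Finset.card_range, nsmul_eq_mul]
  have : ((n + 1 : ℕ) : ℝ) * (ε / (t - s + 1) * Δ) = ε * ((t - s) / (t - s + 1)) := by
    have : t - s + 1 ≠ 0 := by linarith
    rw [hΔ]; push_cast; field_simp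
  rw [this]
  have h3 : (t - s) / (t - s + 1) < 1 := by rw [div_lt_one (by linarith)]; linarith
  nlinarith

/-- The discrete increment. -/
noncomputable def disc {Ω : Type*} (B : ℝ → Ω → ℝ) (T s Δ : ℝ) (N : ℕ) (ω : Ω) : ℝ :=
  ∑ k ∈ Finset.range N,
    ((B (s + (k + 1 : ℕ) * Δ) ω - B (s + k * Δ) ω) -
      ((s + (k + 1 : ℕ) * Δ) - (s + k * Δ)) *
        ((B T ω - B (s + k * Δ) ω) / (T - (s + k * Δ))))

lemma disc_meas {T s Δ : ℝ} (hs : 0 ≤ s) (hΔ : 0 ≤ Δ) (N : ℕ) :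
    Measurable[enlarged B T (s + N * Δ)] (disc B T s Δ N) := by
  unfold disc
  apply Finset.measurable_fun_sum
  intro k hk
  rw [Finset.mem_range] at hk
  have h0 : 0 ≤ (k : ℝ) * Δ := by positivity
  have hk1 : ((k + 1 : ℕ) : ℝ) ≤ N := by exact_mod_cast hk
  have h1 : ((k + 1 : ℕ) : ℝ) * Δ ≤ N * Δ := mul_le_mul_of_nonneg_right hk1 hΔ
  have h2 : (k : ℝ) * Δ ≤ ((k + 1 : ℕ) : ℝ) * Δ := by push_cast; nlinarith
  have m1 : Measurable[enlarged B T (s + N * Δ)] (B (s + (k + 1 : ℕ) * Δ)) :=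
    enlarged_meas T (by linarith) (by linarith)
  have m2 : Measurable[enlarged B T (s + N * Δ)] (B (s + k * Δ)) :=
    enlarged_meas T (by linarith) (by linarith)
  have m3 : Measurable[enlarged B T (s + N * Δ)] (B T) := enlarged_meas_T T
  exact Measurable.sub (Measurable.sub m1 m2)
    (Measurable.const_mul (Measurable.div_const (Measurable.sub m3 m2) _) _)

lemma disc_CG (hB : IsStandardBM μ B) {T s Δ : ℝ} (hs : 0 ≤ s) (hΔ : 0 ≤ Δ) (N : ℕ)
    (hN : s + N * Δ < T) :
    CG μ (disc B T s Δ N) (∑ k ∈ Finset.range N, (Δ - Δ ^ 2 / (T - (s + k * Δ))))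
      (enlarged B T s) := by
  induction N with
  | zero =>
    intro θ A hA
    simp [disc]
  | succ N ih =>
    have hle : s + (N : ℝ) * Δ ≤ s + ((N + 1 : ℕ) : ℝ) * Δ := by push_cast; nlinarith
    have h0 : 0 ≤ (N : ℝ) * Δ := by positivity
    have hst := step_CG hB (u := s + (N : ℝ) * Δ) (v := s + ((N + 1 : ℕ) : ℝ) * Δ) (by linarith)
      hle hN.le (hle.trans_lt hN)
    have hd : (s + ((N + 1 : ℕ) : ℝ) * Δ) - (s + (N : ℝ) * Δ) = Δ := by push_cast; ring
    rw [Finset.sum_range_succ]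
    have hadd := CG.add (enlarged_mono T (by linarith)) (enlarged_le hB T _)
      (disc_meas (B := B) (T := T) hs hΔ N) ?_ ?_ (ih (hle.trans_lt hN)) hst
    · rw [hd] at hadd
      convert hadd using 1
      ext ω
      simp only [disc, Finset.sum_range_succ]
      rw [hd]
    · exact ((hB.meas _).sub (hB.meas _)).sub
        ((((hB.meas _).sub (hB.meas _)).div_const _).const_mul _)
    · rw [hd, sub_nonneg, div_le_iff₀ (by linarith)]
      nlinarith

lemma var_tendsto {T s t : ℝ} (hst : s ≤ t) (htT : t < T) :
    Tendsto (fun n : ℕ => ∑ k ∈ Finset.range (n + 1),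
      ((t - s) / (n + 1) - ((t - s) / (n + 1)) ^ 2 / (T - (s + k * ((t - s) / (n + 1))))))
      atTop (𝓝 (t - s)) := by
  have hl : Tendsto (fun n : ℕ => (t - s) - (t - s) ^ 2 / (T - t) * (1 / ((n : ℝ) + 1)))
      atTop (𝓝 (t - s)) := by
    have := (tendsto_one_div_add_atTop_nhds_zero_nat (𝕜 := ℝ)).const_mul ((t - s) ^ 2 / (T - t))
    simpa using this.const_sub (t - s)
  refine tendsto_of_tendsto_of_tendsto_of_le_of_le hl tendsto_const_nhds ?_ ?_
  · intro n
    have hn1 : (0 : ℝ) < (n : ℝ) + 1 := by positivity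
    have hTt : 0 < T - t := by linarith
    have : ∑ k ∈ Finset.range (n + 1),
      ((t - s) / ((n : ℝ) + 1) - ((t - s) / (n + 1)) ^ 2 / (T - t)) =
      (t - s) - (t - s) ^ 2 / (T - t) * (1 / ((n : ℝ) + 1)) := by
      rw [Finset.sum_const, Finset.card_range, nsmul_eq_mul]; push_cast; field_simp
    simp only
    rw [← this]
    apply Finset.sum_le_sum
    intro k hk
    rw [Finset.mem_range] at hk
    have hk' : (k : ℝ) ≤ (n : ℝ) + 1 := by exact_mod_cast hk.le
    have hΔ0 : 0 ≤ (t - s) / ((n : ℝ) + 1) := div_nonneg (by linarith) hn1.le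
    have : (k : ℝ) * ((t - s) / (n + 1)) ≤ t - s := by
      calc (k : ℝ) * ((t - s) / (n + 1)) ≤ ((n : ℝ) + 1) * ((t - s) / (n + 1)) := by gcongr
        _ = t - s := by field_simp
    gcongr
    linarith
  · intro n
    have hn1 : (0 : ℝ) < (n : ℝ) + 1 := by positivity
    have : ∑ k ∈ Finset.range (n + 1), ((t - s) / ((n : ℝ) + 1)) = t - s := by
      rw [Finset.sum_const, Finset.card_range, nsmul_eq_mul]; push_cast; field_simp
    simp only
    conv_rhs => rw [← this]
    apply Finset.sum_le_sum
    intro k hk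
    rw [Finset.mem_range] at hk
    have hk' : (k : ℝ) ≤ (n : ℝ) + 1 := by exact_mod_cast hk.le
    have hΔ0 : 0 ≤ (t - s) / ((n : ℝ) + 1) := div_nonneg (by linarith) hn1.le
    have : (k : ℝ) * ((t - s) / (n + 1)) ≤ t - s := by
      calc (k : ℝ) * ((t - s) / (n + 1)) ≤ ((n : ℝ) + 1) * ((t - s) / (n + 1)) := by gcongr
        _ = t - s := by field_simp
    have : 0 ≤ ((t - s) / ((n : ℝ) + 1)) ^ 2 / (T - (s + k * ((t - s) / (n + 1)))) :=
      div_nonneg (sq_nonneg _) (by linarith)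
    linarith

lemma disc_tendsto {T s t : ℝ} (hs : 0 ≤ s) (hst : s ≤ t) (htT : t < T) {ω : Ω}
    (hc : ContinuousOn (fun t => B t ω) (Ici 0)) :
    Tendsto (fun n : ℕ => disc B T s ((t - s) / (n + 1)) (n + 1) ω) atTop
      (𝓝 (B t ω - B s ω - ∫ x in s..t, (B T ω - B x ω) / (T - x))) := by
  have hf : ContinuousOn (fun x => (B T ω - B x ω) / (T - x)) (Icc s t) := by
    apply ContinuousOn.div
    · exact continuousOn_const.sub (hc.mono fun x hx => hs.trans hx.1)
    · fun_prop
    · intro x hx; linarith [hx.2]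
  have h := (riemann_tendsto hst hf).const_sub (B t ω - B s ω)
  refine h.congr fun n => ?_
  unfold disc
  rw [Finset.sum_sub_distrib]
  congr 1
  rw [Finset.sum_range_sub (fun k : ℕ => B (s + k * ((t - s) / (n + 1))) ω)]
  congr 2
  · push_cast; field_simp; ring_nf
  · simp

lemma gauss_abs_le {Z : Ω → ℝ} {L : ℝ} (hL : 0 < L)
    (hZ : μ.map Z = gaussianReal 0 L.toNNReal) :
    ∫⁻ ω, ‖Z ω‖ₑ ∂μ ≤ ENNReal.ofReal (√L) := by
  have gZ : HasGaussianLaw Z μ := ⟨by rw [hZ]; infer_instance⟩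
  have eZ : ∫ ω, Z ω ∂μ = 0 := by
    have := integral_map gZ.aemeasurable (f := fun x : ℝ => x) (by fun_prop)
    rw [← this, hZ, integral_id_gaussianReal]
  have vZ : ∫ ω, Z ω ^ 2 ∂μ = L := by
    have h1 : Var[Z; μ] = L := by
      rw [← variance_id_map gZ.aemeasurable, hZ, variance_id_gaussianReal]
      simp [hL.le]
    rw [variance_of_integral_eq_zero gZ.aemeasurable eZ] at h1
    exact h1
  have hs : 0 < √L := Real.sqrt_pos.2 hL
  have hss : √L * √L = L := Real.mul_self_sqrt hL.le
  have hsq : Integrable (fun ω => Z ω ^ 2) μ := gZ.memLp_two.integrable_sq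
  have : ∫⁻ ω, ‖Z ω‖ₑ ∂μ = ENNReal.ofReal (∫ ω, ‖Z ω‖ ∂μ) := by
    rw [ofReal_integral_norm_eq_lintegral_enorm gZ.integrable]
  rw [this]
  apply ENNReal.ofReal_le_ofReal
  calc ∫ ω, ‖Z ω‖ ∂μ ≤ ∫ ω, (√L + Z ω ^ 2 / √L) / 2 ∂μ := by
        apply integral_mono gZ.integrable.norm
        · exact (((integrable_const _).add (hsq.div_const _)).div_const _)
        · intro ω
          simp only [Real.norm_eq_abs]
          rw [le_div_iff₀ (by norm_num), ← sub_nonneg]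
          have : √L + Z ω ^ 2 / √L - |Z ω| * 2 = (√L - |Z ω|) ^ 2 / √L := by
            rw [← sq_abs (Z ω)]; field_simp; ring
          rw [this]; positivity
    _ = √L := by
        rw [integral_div, integral_add (integrable_const _) (hsq.div_const _), integral_div, vZ]
        simp only [integral_const, probReal_univ, one_smul]
        have : L / √L = √L := by rw [div_eq_iff hs.ne', hss]
        rw [this]
        ring

lemma ae_integrable (hB : IsStandardBM μ B) {T : ℝ} (hT : 0 < T) :
    ∀ᵐ ω ∂μ, IntervalIntegrable (fun x => (B T ω - B x ω) / (T - x)) volume 0 T := by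
  set bad : Set Ω := toMeasurable μ {ω | ¬ ContinuousOn (fun t => B t ω) (Set.Ici 0)} with hbad
  have hb0 : μ bad = 0 := by rw [hbad, measure_toMeasurable]; exact hB.cont
  have hbm : MeasurableSet bad := measurableSet_toMeasurable _ _
  have hbae : ∀ᵐ ω ∂μ, ω ∈ badᶜ := by
    rw [ae_iff]; simpa using hb0
  let u : ℝ → Ω → ℝ := fun x => badᶜ.indicator (B (max x 0))
  have hu : Measurable (Function.uncurry u) := by
    apply measurable_uncurry_of_continuous_of_measurable
    · intro ω
      by_cases hω : ω ∈ bad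
      · simp [u, hω, continuous_const]
      · have hc : ContinuousOn (fun t => B t ω) (Set.Ici 0) := by
          by_contra hcon
          exact hω (subset_toMeasurable _ _ hcon)
        simp only [u, mem_compl_iff, hω, not_false_eq_true, indicator_of_mem]
        exact hc.comp_continuous (by fun_prop) (fun x => mem_Ici.2 (le_max_right _ _))
    · intro x
      exact (hB.meas _).indicator hbm.compl
  let H : ℝ → Ω → ℝ := fun x ω => (B T ω - u x ω) / (T - x)
  have hH : Measurable (Function.uncurry H) := by
    have h1 : Measurable (fun p : ℝ × Ω => B T p.2) := (hB.meas T).comp measurable_snd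
    have h2 : Measurable (fun p : ℝ × Ω => u p.1 p.2) := hu
    have h3 : Measurable (fun p : ℝ × Ω => T - p.1) := measurable_const.sub measurable_fst
    exact (h1.sub h2).div h3
  have hfin : ∫⁻ ω, (∫⁻ x in Ioo 0 T, ‖H x ω‖ₑ) ∂μ < ⊤ := by
    rw [lintegral_lintegral_swap (f := fun ω x => ‖H x ω‖ₑ)]
    · have hrp : IntervalIntegrable (fun x : ℝ => (T - x) ^ (-(1 / 2) : ℝ)) volume 0 T := by
        have := (intervalIntegral.intervalIntegrable_rpow' (a := 0) (b := T)
          (r := (-(1 / 2) : ℝ)) (by norm_num)).comp_sub_left T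
        simp only [sub_zero, sub_self] at this
        exact this.symm
      rw [intervalIntegrable_iff_integrableOn_Ioo_of_le hT.le] at hrp
      refine lt_of_le_of_lt ?_ hrp.2
      refine setLIntegral_mono' measurableSet_Ioo fun x hx => ?_
      have hL : 0 < T - x := by linarith [hx.2]
      have e1 : ∫⁻ ω, ‖H x ω‖ₑ ∂μ = ∫⁻ ω, ‖B T ω - B x ω‖ₑ * ‖(T - x)⁻¹‖ₑ ∂μ := by
        apply lintegral_congr_ae
        filter_upwards [hbae] with ω hω
        simp only [H, u, indicator_of_mem hω, max_eq_left hx.1.le, div_eq_mul_inv, enorm_mul]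
      have hmm : Measurable (fun ω => B T ω - B x ω) := (hB.meas T).sub (hB.meas x)
      rw [e1, lintegral_mul_const _ hmm.enorm]
      calc _ ≤ ENNReal.ofReal (√(T - x)) * ‖(T - x)⁻¹‖ₑ := by
            gcongr
            exact gauss_abs_le hL (hB.gauss x T hx.1.le hx.2.le)
        _ = ‖(T - x) ^ (-(1 / 2) : ℝ)‖ₑ := by
            rw [Real.enorm_eq_ofReal (by positivity), Real.enorm_eq_ofReal (by positivity),
              ← ENNReal.ofReal_mul (by positivity)]
            congr 1
            rw [Real.sqrt_eq_rpow, ← Real.rpow_neg_one, ← Real.rpow_add hL]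
            norm_num
    · exact (hH.comp measurable_swap).enorm.aemeasurable
  have hae := ae_lt_top (by
    exact Measurable.lintegral_prod_right' (f := fun p : Ω × ℝ => ‖H p.2 p.1‖ₑ)
      (hH.comp measurable_swap).enorm) hfin.ne
  filter_upwards [hae, hbae] with ω h1 h2
  rw [intervalIntegrable_iff_integrableOn_Ioo_of_le hT.le]
  have h3 : IntegrableOn (fun x => H x ω) (Ioo 0 T) :=
    ⟨(hH.comp measurable_prodMk_right).aestronglyMeasurable, h1⟩
  refine h3.congr_fun (fun x hx => ?_) measurableSet_Ioo
  simp only [H, u, indicator_of_mem h2, max_eq_left hx.1.le]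

lemma good_sub {T s t : ℝ} (hs : 0 ≤ s) (hst : s ≤ t) (htT : t ≤ T) {ω : Ω}
    (hi : IntervalIntegrable (fun x => (B T ω - B x ω) / (T - x)) volume 0 T) :
    (B t ω - ∫ x in (0 : ℝ)..t, (B T ω - B x ω) / (T - x)) -
      (B s ω - ∫ x in (0 : ℝ)..s, (B T ω - B x ω) / (T - x)) =
    B t ω - B s ω - ∫ x in s..t, (B T ω - B x ω) / (T - x) := by
  have h1 : IntervalIntegrable (fun x => (B T ω - B x ω) / (T - x)) volume 0 s :=
    hi.mono_set (by rw [uIcc_of_le hs, uIcc_of_le (hs.trans (hst.trans htT))]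
                    exact Icc_subset_Icc le_rfl (hst.trans htT))
  have h2 : IntervalIntegrable (fun x => (B T ω - B x ω) / (T - x)) volume 0 t :=
    hi.mono_set (by rw [uIcc_of_le (hs.trans hst), uIcc_of_le (hs.trans (hst.trans htT))]
                    exact Icc_subset_Icc le_rfl htT)
  rw [← intervalIntegral.integral_interval_sub_left h2 h1]
  ring

lemma good_cont {T : ℝ} (hT : 0 < T) {ω : Ω} (hc : ContinuousOn (fun t => B t ω) (Ici 0))
    (hi : IntervalIntegrable (fun x => (B T ω - B x ω) / (T - x)) volume 0 T) :
    ContinuousOn (fun t => B t ω - ∫ x in (0 : ℝ)..t, (B T ω - B x ω) / (T - x)) (Icc 0 T) := by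
  apply ContinuousOn.sub (hc.mono fun x hx => hx.1)
  have := intervalIntegral.continuousOn_primitive_interval (μ := volume)
    (f := fun x => (B T ω - B x ω) / (T - x)) (a := 0) (b := T) ?_
  · rwa [uIcc_of_le hT.le] at this
  · rw [uIcc_of_le hT.le]
    exact (intervalIntegrable_iff_integrableOn_Icc_of_le hT.le).1 hi

lemma seq_T {T s : ℝ} (hsT : s < T) :
    (∀ n : ℕ, s ≤ T - (T - s) * (1 / ((n : ℝ) + 1)) ∧ T - (T - s) * (1 / ((n : ℝ) + 1)) < T) ∧
    Tendsto (fun n : ℕ => T - (T - s) * (1 / ((n : ℝ) + 1))) atTop (𝓝 T) := by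
  refine ⟨fun n => ?_, ?_⟩
  · have hn1 : (0 : ℝ) < (n : ℝ) + 1 := by positivity
    have h1 : 1 / ((n : ℝ) + 1) ≤ 1 := by
      rw [div_le_one hn1]; linarith [(Nat.cast_nonneg n : (0 : ℝ) ≤ n)]
    have h2 : 0 < 1 / ((n : ℝ) + 1) := by positivity
    constructor <;> nlinarith
  · have := (tendsto_one_div_add_atTop_nhds_zero_nat (𝕜 := ℝ)).const_mul (T - s)
    simpa using this.const_sub T

section gam
variable {γ : ℝ → Ω → ℝ} {T : ℝ}

lemma gam_tendsto (hB : IsStandardBM μ B) (hT : 0 < T)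
    (hγ : ∀ t ω, γ t ω = B t ω - ∫ s in (0 : ℝ)..t, (B T ω - B s ω) / (T - s))
    {s : ℝ} (hs : 0 ≤ s) (hsT : s < T) :
    ∀ᵐ ω ∂μ, Tendsto (fun n : ℕ => γ (T - (T - s) * (1 / ((n : ℝ) + 1))) ω) atTop
      (𝓝 (γ T ω)) := by
  filter_upwards [hB.cont, ae_integrable hB hT] with ω hc hi
  have hcont := good_cont hT hc hi
  simp only [← hγ] at hcont
  have h1 := hcont T ⟨hT.le, le_rfl⟩
  refine h1.tendsto.comp (tendsto_nhdsWithin_iff.2 ⟨(seq_T hsT).2, ?_⟩)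
  filter_upwards with n
  exact ⟨hs.trans ((seq_T hsT).1 n).1, ((seq_T hsT).1 n).2.le⟩

lemma gam_version (hB : IsStandardBM μ B) (hT : 0 < T)
    (hγ : ∀ t ω, γ t ω = B t ω - ∫ s in (0 : ℝ)..t, (B T ω - B s ω) / (T - s))
    {t : ℝ} (ht : 0 ≤ t) (htT : t ≤ T) :
    ∃ g : Ω → ℝ, Measurable[enlarged B T t] g ∧ γ t =ᵐ[μ] g := by
  have main : ∀ t, 0 ≤ t → t < T → ∃ g : Ω → ℝ, Measurable[enlarged B T t] g ∧ γ t =ᵐ[μ] g := by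
    intro t ht htT
    apply ae_limit_measurable (f := fun n : ℕ => disc B T 0 ((t - 0) / ((n : ℝ) + 1)) (n + 1))
    · intro n
      refine ⟨_, ?_, ae_eq_refl _⟩
      have hn1 : (0 : ℝ) < (n : ℝ) + 1 := by positivity
      have := disc_meas (B := B) (T := T) (s := 0) (Δ := (t - 0) / ((n : ℝ) + 1)) le_rfl
        (by rw [sub_zero]; positivity) (n + 1)
      have e : (0 : ℝ) + ((n + 1 : ℕ) : ℝ) * ((t - 0) / ((n : ℝ) + 1)) = t := by
        push_cast; field_simp; ring
      rwa [e] at this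
    · filter_upwards [hB.cont, hB.zero] with ω hc h0
      have := disc_tendsto le_rfl ht htT hc
      rwa [h0, sub_zero (B t ω), ← hγ] at this
  rcases htT.lt_or_eq with h | rfl
  · exact main t ht h
  · apply ae_limit_measurable (f := fun n : ℕ => γ (t - (t - 0) * (1 / ((n : ℝ) + 1))))
    · intro n
      have h := (seq_T hT).1 n
      obtain ⟨g, hg, he⟩ := main _ h.1 h.2
      exact ⟨g, hg.mono (enlarged_mono t h.2.le) le_rfl, he⟩
    · exact gam_tendsto hB hT hγ le_rfl hT

lemma gam_aemeas (hB : IsStandardBM μ B) (hT : 0 < T)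
    (hγ : ∀ t ω, γ t ω = B t ω - ∫ s in (0 : ℝ)..t, (B T ω - B s ω) / (T - s))
    {t : ℝ} (ht : 0 ≤ t) (htT : t ≤ T) : AEMeasurable (γ t) μ := by
  obtain ⟨g, hg, he⟩ := gam_version hB hT hγ ht htT
  exact ⟨g, hg.mono (enlarged_le hB T t) le_rfl, he⟩

lemma gam_CG (hB : IsStandardBM μ B) (hT : 0 < T)
    (hγ : ∀ t ω, γ t ω = B t ω - ∫ s in (0 : ℝ)..t, (B T ω - B s ω) / (T - s))
    {s t : ℝ} (hs : 0 ≤ s) (hst : s ≤ t) (htT : t ≤ T) :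
    CG μ (fun ω => γ t ω - γ s ω) (t - s) (enlarged B T s) := by
  have main : ∀ t, s ≤ t → t < T →
      CG μ (fun ω => γ t ω - γ s ω) (t - s) (enlarged B T s) := by
    intro t hst htT
    refine CG.tendsto (D := fun n : ℕ => disc B T s ((t - s) / ((n : ℝ) + 1)) (n + 1))
      ?_ ?_ (var_tendsto hst htT) ?_
    · intro n
      exact ((disc_meas (B := B) (T := T) hs
        (div_nonneg (by linarith) (by positivity)) (n + 1)).mono
        (enlarged_le hB T _) le_rfl).aemeasurable
    · intro n
      apply disc_CG hB hs (div_nonneg (by linarith) (by positivity)) (n + 1)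
      have hn1 : (0 : ℝ) < (n : ℝ) + 1 := by positivity
      have e : s + ((n + 1 : ℕ) : ℝ) * ((t - s) / ((n : ℝ) + 1)) = t := by
        push_cast; field_simp; ring
      rwa [e]
    · filter_upwards [hB.cont, ae_integrable hB hT] with ω hc hi
      have := disc_tendsto hs hst htT hc
      rwa [← good_sub hs hst htT.le hi, ← hγ, ← hγ] at this
  rcases htT.lt_or_eq with h | rfl
  · exact main t hst h
  · rcases hst.lt_or_eq with h | rfl
    · have hq := seq_T h
      refine CG.tendsto (D := fun n : ℕ => fun ω =>
          γ (t - (t - s) * (1 / ((n : ℝ) + 1))) ω - γ s ω)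
        ?_ (fun n => main _ (hq.1 n).1 (hq.1 n).2) (hq.2.sub_const s) ?_
      · intro n
        exact (gam_aemeas hB hT hγ (hs.trans (hq.1 n).1) (hq.1 n).2.le).sub
          (gam_aemeas hB hT hγ hs hst)
      · filter_upwards [gam_tendsto hB hT hγ hs h] with ω hω
        exact hω.sub_const _
    · intro θ A hA
      simp

end gam
end BMlemmas

section final
variable {Ω : Type*} [MeasurableSpace Ω] {μ : Measure Ω} [IsProbabilityMeasure μ]
  {B : ℝ → Ω → ℝ} {T : ℝ}

/-- Independence of an adapted process with conditionally independent increments from `B_T`. -/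
lemma indep_finset (hB : IsStandardBM μ B) {g : ℝ → Ω → ℝ}
    (hg : ∀ t, 0 ≤ t → t ≤ T → Measurable[enlarged B T t] (g t))
    (hinc : ∀ s t, 0 ≤ s → s ≤ t → t ≤ T →
      Indep (MeasurableSpace.comap (fun ω => g t ω - g s ω) inferInstance) (enlarged B T s) μ)
    (hzero : ∀ t, 0 ≤ t → t ≤ T →
      Indep (MeasurableSpace.comap (g t) inferInstance) (enlarged B T 0) μ)
    (S : Finset ℝ) (hS : ∀ t ∈ S, 0 ≤ t ∧ t ≤ T) :
    Indep (⨆ t ∈ S, MeasurableSpace.comap (g t) inferInstance)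
      (MeasurableSpace.comap (B T) inferInstance) μ := by
  have hgm : ∀ t, 0 ≤ t → t ≤ T → Measurable (g t) := fun t h0 h1 =>
    (hg t h0 h1).mono (enlarged_le hB T t) le_rfl
  induction S using Finset.induction_on_max with
  | empty => simpa using indep_bot_left _
  | insert t S hmax ih =>
    have ht := hS t (Finset.mem_insert_self _ _)
    have hS' : ∀ r ∈ S, 0 ≤ r ∧ r ≤ T := fun r hr => hS r (Finset.mem_insert_of_mem hr)
    rw [Finset.iSup_insert]
    rcases S.eq_empty_or_nonempty with rfl | hne
    · simpa using indep_of_indep_of_le_right (hzero t ht.1 ht.2) le_sup_right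
    · set s := S.max' hne with hs
      have hsS : s ∈ S := S.max'_mem hne
      have hst : s ≤ t := (hmax s hsS).le
      have hs0 := hS' s hsS
      have hD := hinc s t hs0.1 hst ht.2
      have hDm : Measurable (fun ω => g t ω - g s ω) := (hgm t ht.1 ht.2).sub (hgm s hs0.1 hs0.2)
      have hG : (⨆ r ∈ S, MeasurableSpace.comap (g r) inferInstance) ≤ enlarged B T s := by
        refine iSup₂_le fun r hr => Measurable.comap_le ?_
        exact (hg r (hS' r hr).1 (hS' r hr).2).mono (enlarged_mono T (S.le_max' r hr)) le_rfl
      have h1 : Indep (MeasurableSpace.comap (B T) inferInstance ⊔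
          ⨆ r ∈ S, MeasurableSpace.comap (g r) inferInstance)
          (MeasurableSpace.comap (fun ω => g t ω - g s ω) inferInstance) μ :=
        (indep_of_indep_of_le_right hD (sup_le le_sup_right hG)).symm
      have h2 := indep_aux (hB.meas T).comap_le (hG.trans (enlarged_le hB T s)) hDm.comap_le
        (ih hS').symm h1
      refine (indep_of_indep_of_le_right h2 ?_).symm
      refine sup_le ?_ le_sup_left
      apply Measurable.comap_le
      have e : g t = fun ω => (g t ω - g s ω) + g s ω := by ext ω; ring
      have key : ∀ m : MeasurableSpace Ω, Measurable[m] (fun ω => g t ω - g s ω) →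
          Measurable[m] (g s) → Measurable[m] (g t) := by
        intro m ha hb
        have hab := ha.add hb
        rw [e]
        exact hab
      refine key _ ((comap_measurable (fun ω => g t ω - g s ω)).mono le_sup_right le_rfl) ?_
      refine (comap_measurable (g s)).mono (le_trans ?_ le_sup_left) le_rfl
      exact le_iSup₂_of_le (f := fun r (_ : r ∈ S) =>
        MeasurableSpace.comap (g r) inferInstance) s hsS le_rfl

lemma indep_all (hB : IsStandardBM μ B) {g : ℝ → Ω → ℝ}
    (hg : ∀ t, 0 ≤ t → t ≤ T → Measurable[enlarged B T t] (g t))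
    (hinc : ∀ s t, 0 ≤ s → s ≤ t → t ≤ T →
      Indep (MeasurableSpace.comap (fun ω => g t ω - g s ω) inferInstance) (enlarged B T s) μ)
    (hzero : ∀ t, 0 ≤ t → t ≤ T →
      Indep (MeasurableSpace.comap (g t) inferInstance) (enlarged B T 0) μ) :
    Indep (⨆ t ∈ Set.Icc (0 : ℝ) T, MeasurableSpace.comap (g t) inferInstance)
      (MeasurableSpace.comap (B T) inferInstance) μ := by
  let M : {S : Finset ℝ // ∀ t ∈ S, 0 ≤ t ∧ t ≤ T} → MeasurableSpace Ω :=
    fun S => ⨆ t ∈ S.1, MeasurableSpace.comap (g t) inferInstance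
  have h1 : Indep (⨆ S, M S) (MeasurableSpace.comap (B T) inferInstance) μ := by
    refine indep_iSup_of_directed_le (fun S => indep_finset hB hg hinc hzero S.1 S.2) ?_
      (hB.meas T).comap_le ?_
    · intro S
      exact iSup₂_le fun t ht => Measurable.comap_le
        ((hg t (S.2 t ht).1 (S.2 t ht).2).mono (enlarged_le hB T t) le_rfl)
    · intro S S'
      refine ⟨⟨S.1 ∪ S'.1, fun t ht => ?_⟩, ?_, ?_⟩
      · rcases Finset.mem_union.1 ht with h | h
        · exact S.2 t h
        · exact S'.2 t h
      · exact biSup_mono fun t ht => Finset.mem_union_left _ ht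
      · exact biSup_mono fun t ht => Finset.mem_union_right _ ht
  refine indep_of_indep_of_le_left h1 (iSup₂_le fun t ht => ?_)
  refine le_trans ?_ (le_iSup M ⟨{t}, by simpa using ht⟩)
  simp [M]

lemma indep_ae {g γ : ℝ → Ω → ℝ} {m : MeasurableSpace Ω} {I : Set ℝ}
    (h : ∀ t ∈ I, γ t =ᵐ[μ] g t)
    (hi : Indep (⨆ t ∈ I, MeasurableSpace.comap (g t) inferInstance) m μ) :
    Indep (⨆ t ∈ I, MeasurableSpace.comap (γ t) inferInstance) m μ := by
  have hle : (⨆ t ∈ I, MeasurableSpace.comap (γ t) inferInstance) ≤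
      eventuallyMeasurableSpace (⨆ t ∈ I, MeasurableSpace.comap (g t) inferInstance) (ae μ) := by
    refine iSup₂_le fun t ht => ?_
    rintro _ ⟨A, hA, rfl⟩
    refine ⟨g t ⁻¹' A, ?_, (h t ht).preimage A⟩
    exact le_iSup₂_of_le (f := fun r (_ : r ∈ I) =>
        MeasurableSpace.comap (g r) inferInstance) t ht le_rfl _ ⟨A, hA, rfl⟩
  rw [Indep_iff] at hi ⊢
  intro A C hA hC
  obtain ⟨A', hA', he⟩ := hle A hA
  rw [measure_congr he, measure_congr (he.inter (ae_eq_refl C))]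
  exact hi A' C hA' hC

end final

/-- For a standard Brownian motion `B` and `T > 0`, the process
`γ^{(T)}_t = B_t − ∫_0^t (B_T − B_s)/(T − s) ds`, `0 ≤ t ≤ T`, is a standard Brownian
motion on `[0,T]` with respect to the initially enlarged filtration
`B^{(T)}_t = σ(B_r : r ≤ t) ∨ σ(B_T)`: it has a.s. continuous paths, starts at `0`, its
increments are independent of the enlarged past and Gaussian `N(0, t−s)`; in particular
it is a martingale with respect to `(B^{(T)}_t)_{0 ≤ t ≤ T}` and the whole process
`(γ^{(T)}_t)_{0 ≤ t ≤ T}` is independent of `B_T`. -/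
theorem brownian_bridge_enlargement
    {Ω : Type*} [MeasurableSpace Ω] (μ : Measure Ω) [IsProbabilityMeasure μ]
    (B : ℝ → Ω → ℝ) (hB : IsStandardBM μ B)
    (T : ℝ) (hT : 0 < T)
    (γ : ℝ → Ω → ℝ)
    (hγ : ∀ t ω, γ t ω = B t ω - ∫ s in (0 : ℝ)..t, (B T ω - B s ω) / (T - s)) :
    (∀ᵐ ω ∂μ, ContinuousOn (fun t => γ t ω) (Set.Icc 0 T)) ∧
    (∀ᵐ ω ∂μ, γ 0 ω = 0) ∧
    (∀ s t : ℝ, 0 ≤ s → s ≤ t → t ≤ T →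
      Indep (MeasurableSpace.comap (fun ω => γ t ω - γ s ω) inferInstance)
          (enlarged B T s) μ ∧
        μ.map (fun ω => γ t ω - γ s ω) = gaussianReal 0 (Real.toNNReal (t - s))) ∧
    (∀ t : ℝ, 0 ≤ t → t ≤ T → Integrable (γ t) μ) ∧
    (∀ s t : ℝ, 0 ≤ s → s ≤ t → t ≤ T →
      μ[γ t | enlarged B T s] =ᵐ[μ] γ s) ∧
    Indep (⨆ t ∈ Set.Icc (0 : ℝ) T, MeasurableSpace.comap (γ t) inferInstance)
      (MeasurableSpace.comap (B T) inferInstance) μ := by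
  have hcg := fun {s t : ℝ} (hs : 0 ≤ s) (hst : s ≤ t) (htT : t ≤ T) =>
    gam_CG hB hT hγ hs hst htT
  have ham := fun {t : ℝ} (ht : 0 ≤ t) (htT : t ≤ T) => gam_aemeas hB hT hγ ht htT
  have h0 : ∀ᵐ ω ∂μ, γ 0 ω = 0 := by
    filter_upwards [hB.zero] with ω h
    rw [hγ, h]; simp
  have hinc : ∀ s t : ℝ, 0 ≤ s → s ≤ t → t ≤ T →
      Indep (MeasurableSpace.comap (fun ω => γ t ω - γ s ω) inferInstance)
          (enlarged B T s) μ ∧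
        μ.map (fun ω => γ t ω - γ s ω) = gaussianReal 0 (Real.toNNReal (t - s)) :=
    fun s t hs hst htT => (hcg hs hst htT).indep_map (by linarith) (enlarged_le hB T s)
      ((ham (hs.trans hst) htT).sub (ham hs (hst.trans htT)))
  have hcg0 : ∀ t, 0 ≤ t → t ≤ T → CG μ (γ t) t (enlarged B T 0) := by
    intro t ht htT
    have := hcg le_rfl ht htT
    rw [sub_zero] at this
    refine this.congr ?_
    filter_upwards [h0] with ω h
    rw [h, sub_zero]
  have hIntg : ∀ t : ℝ, 0 ≤ t → t ≤ T → Integrable (γ t) μ := by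
    intro t ht htT
    have hm := ((hcg0 t ht htT).indep_map ht (enlarged_le hB T 0) (ham ht htT)).2
    have gZ : HasGaussianLaw (γ t) μ := ⟨by rw [hm]; infer_instance⟩
    exact gZ.integrable
  have hver : ∀ t : ℝ, ∃ g : Ω → ℝ, 0 ≤ t → t ≤ T →
      Measurable[enlarged B T t] g ∧ γ t =ᵐ[μ] g := by
    intro t
    by_cases h : 0 ≤ t ∧ t ≤ T
    · obtain ⟨g, hg⟩ := gam_version hB hT hγ h.1 h.2
      exact ⟨g, fun _ _ => hg⟩
    · exact ⟨0, fun h1 h2 => absurd ⟨h1, h2⟩ h⟩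
  choose g hg using hver
  have hgm : ∀ t, 0 ≤ t → t ≤ T → Measurable (g t) := fun t h1 h2 =>
    (hg t h1 h2).1.mono (enlarged_le hB T t) le_rfl
  have hginc : ∀ s t, 0 ≤ s → s ≤ t → t ≤ T →
      Indep (MeasurableSpace.comap (fun ω => g t ω - g s ω) inferInstance) (enlarged B T s) μ ∧
      μ.map (fun ω => g t ω - g s ω) = gaussianReal 0 (Real.toNNReal (t - s)) := by
    intro s t hs hst htT
    refine CG.indep_map ((hcg hs hst htT).congr ?_) (by linarith) (enlarged_le hB T s)
      ((hgm t (hs.trans hst) htT).sub (hgm s hs (hst.trans htT))).aemeasurable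
    filter_upwards [(hg t (hs.trans hst) htT).2, (hg s hs (hst.trans htT)).2] with ω h1 h2
    rw [h1, h2]
  refine ⟨?_, h0, hinc, hIntg, ?_, ?_⟩
  · filter_upwards [hB.cont, ae_integrable hB hT] with ω hc hi
    have := good_cont hT hc hi
    simpa only [← hγ] using this
  · intro s t hs hst htT
    have hD := hginc s t hs hst htT
    have hsT := hst.trans htT
    have ht0 := hs.trans hst
    have hgs := hg s hs hsT
    have hgt := hg t ht0 htT
    let D : Ω → ℝ := fun ω => g t ω - g s ω
    have hDm : Measurable D := (hgm t ht0 htT).sub (hgm s hs hsT)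
    have gD : HasGaussianLaw D μ := ⟨by rw [hD.2]; infer_instance⟩
    have hgi : Integrable (g s) μ := (hIntg s hs hsT).congr hgs.2
    have e1 : γ t =ᵐ[μ] D + g s := by
      filter_upwards [hgt.2] with ω h
      simp [D, h]
    have e2 : μ[D | enlarged B T s] =ᵐ[μ] fun _ => ∫ ω, D ω ∂μ :=
      condExp_indep_eq hDm.comap_le (enlarged_le hB T s)
        (comap_measurable D).stronglyMeasurable hD.1
    have e3 : ∫ ω, D ω ∂μ = 0 := by
      have := integral_map gD.aemeasurable (f := fun x : ℝ => x) (by fun_prop)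
      rw [← this, hD.2, integral_id_gaussianReal]
    have e4 : μ[g s | enlarged B T s] = g s :=
      condExp_of_stronglyMeasurable (enlarged_le hB T s) hgs.1.stronglyMeasurable hgi
    refine (condExp_congr_ae e1).trans
      ((condExp_add gD.integrable hgi (enlarged B T s)).trans ?_)
    rw [e4]
    filter_upwards [e2, hgs.2] with ω h1 h2
    simp [h1, h2, e3]
  · refine indep_ae (g := g) (fun t ht => (hg t ht.1 ht.2).2) ?_
    refine indep_all hB (fun t h1 h2 => (hg t h1 h2).1)
      (fun s t hs hst htT => (hginc s t hs hst htT).1) ?_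
    intro t h1 h2
    exact (CG.indep_map ((hcg0 t h1 h2).congr (hg t h1 h2).2) h1 (enlarged_le hB T 0)
      (hgm t h1 h2).aemeasurable).1
end
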